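/- Let P be a convex-ranged probability charge on an algebra Σ and let μ ∈ ba be a bounded signed charge whose positive part μ⁺ (given by μ⁺(A) = sup{μ(B) : B ∈ Σ, B ⊆ A}) satisfies μ⁺ ≪ P (i.e., P(A) = 0 implies μ⁺(A) = 0). Define s_μ(A) = sup{μ(B) : B ∈ Σ, P(B) = P(A)}. Then s_μ is a bounded game (s_μ(∅) = 0 and sup_{A∈Σ} |s_μ(A)| < ∞) that is submodular (s_μ(A) + s_μ(B) ≥ s_μ(A ∩ B) + s_μ(A ∪ B) for all A, B ∈ Σ), and for every A ∈ Σ with P(A) ∈ (0,1) one has s_μ(A) ≥ μ(Ω)·P(A). -/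

import Mathlib

/-- A bounded signed charge on the algebra `S` of subsets of `Ω`: a finitely additive,
bounded real-valued set function, normalised to vanish outside `S`. -/
structure Charge {Ω : Type*} (S : Set (Set Ω)) where
  toFun : Set Ω → ℝ
  zero_of_not_mem : ∀ A : Set Ω, A ∉ S → toFun A = 0
  additive : ∀ A B : Set Ω, A ∈ S → B ∈ S → Disjoint A B → toFun (A ∪ B) = toFun A + toFun B
  bounded : ∃ C : ℝ, ∀ A : Set Ω, |toFun A| ≤ C

namespace Charge

variable {Ω : Type*} {S : Set (Set Ω)}

theorem ext' {μ ν : Charge S} (h : μ.toFun = ν.toFun) : μ = ν := by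
  cases μ; cases ν; simpa using h

noncomputable instance : SMul ℝ (Charge S) :=
  ⟨fun a μ =>
    { toFun := fun A => a * μ.toFun A
      zero_of_not_mem := fun A hA => by
        show a * μ.toFun A = 0
        rw [μ.zero_of_not_mem A hA, mul_zero]
      additive := fun A B hA hB hAB => by
        show a * μ.toFun (A ∪ B) = a * μ.toFun A + a * μ.toFun B
        rw [μ.additive A B hA hB hAB]; ring
      bounded := by
        obtain ⟨C, hC⟩ := μ.bounded
        refine ⟨|a| * C, fun A => ?_⟩
        show |a * μ.toFun A| ≤ |a| * C
        rw [abs_mul]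
        exact mul_le_mul_of_nonneg_left (hC A) (abs_nonneg a) }⟩

@[simp] theorem smul_toFun (a : ℝ) (μ : Charge S) (A : Set Ω) :
    (a • μ).toFun A = a * μ.toFun A := rfl

/-- The setwise (partial) order on bounded charges. -/
instance : PartialOrder (Charge S) where
  le μ ν := ∀ A ∈ S, μ.toFun A ≤ ν.toFun A
  le_refl μ A _ := le_refl _
  le_trans μ ν ξ h1 h2 A hA := le_trans (h1 A hA) (h2 A hA)
  le_antisymm μ ν h1 h2 := ext' (funext fun A => by
    by_cases hA : A ∈ S
    · exact le_antisymm (h1 A hA) (h2 A hA)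
    · rw [μ.zero_of_not_mem A hA, ν.zero_of_not_mem A hA])

theorem le_def {μ ν : Charge S} : μ ≤ ν ↔ ∀ A ∈ S, μ.toFun A ≤ ν.toFun A := Iff.rfl

end Charge

/-- A probability charge: nonnegative, with total mass one. -/
def IsProbCharge {Ω : Type*} {S : Set (Set Ω)} (P : Charge S) : Prop :=
  P.toFun Set.univ = 1 ∧ ∀ A : Set Ω, 0 ≤ P.toFun A

/-- A charge `P` has convex range if for every `A ∈ S` the set of values `P(B)`,
`B ∈ S`, `B ⊆ A`, is the full interval `[0, P(A)]`. -/
def HasConvexRange {Ω : Type*} {S : Set (Set Ω)} (P : Charge S) : Prop :=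
  ∀ A ∈ S, {x : ℝ | ∃ B ∈ S, B ⊆ A ∧ P.toFun B = x} = Set.Icc 0 (P.toFun A)

/-- The loose anticore of a set function `v`. -/
def LooseAnticore {Ω : Type*} {S : Set (Set Ω)} (v : Set Ω → ℝ) : Set (Charge S) :=
  {μ | ∀ A ∈ S, μ.toFun A ≤ v A}

/-- The anticore of a set function `v`. -/
def Anticore {Ω : Type*} {S : Set (Set Ω)} (v : Set Ω → ℝ) : Set (Charge S) :=
  {μ | μ ∈ LooseAnticore v ∧ μ.toFun Set.univ = v Set.univ}

/-- The loose core of a set function `v`. -/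
def LooseCore {Ω : Type*} {S : Set (Set Ω)} (v : Set Ω → ℝ) : Set (Charge S) :=
  {μ | ∀ A ∈ S, v A ≤ μ.toFun A}

/-- The core of a set function `v`. -/
def Core {Ω : Type*} {S : Set (Set Ω)} (v : Set Ω → ℝ) : Set (Charge S) :=
  {μ | μ ∈ LooseCore v ∧ μ.toFun Set.univ = v Set.univ}

/-- The positive part of a charge: `μ⁺(A) = sup{μ(B) : B ∈ S, B ⊆ A}`. -/
noncomputable def posPartFun {Ω : Type*} {S : Set (Set Ω)} (μ : Charge S) : Set Ω → ℝ :=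
  fun A => sSup {x : ℝ | ∃ B ∈ S, B ⊆ A ∧ x = μ.toFun B}

/-- The `P`-invariant envelope `s_μ(A) = sup{μ(B) : B ∈ S, P(B) = P(A)}`. -/
noncomputable def smu {Ω : Type*} {S : Set (Set Ω)} (P μ : Charge S) : Set Ω → ℝ :=
  fun A => sSup {x : ℝ | ∃ B ∈ S, P.toFun B = P.toFun A ∧ x = μ.toFun B}

namespace Charge

variable {Ω : Type*} {S : Set (Set Ω)}

theorem toFun_empty (hS : MeasureTheory.IsSetAlgebra S) (ν : Charge S) : ν.toFun ∅ = 0 := by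
  have h := ν.additive ∅ ∅ hS.empty_mem hS.empty_mem (Set.disjoint_empty ∅)
  rw [Set.union_empty] at h
  linarith

theorem toFun_inter_add_diff (hS : MeasureTheory.IsSetAlgebra S) (ν : Charge S) {A B : Set Ω}
    (hA : A ∈ S) (hB : B ∈ S) : ν.toFun (A ∩ B) + ν.toFun (A \ B) = ν.toFun A := by
  rw [← ν.additive _ _ (hS.inter_mem hA hB) (hS.sdiff_mem hA hB)
    (Set.disjoint_left.2 fun _ h h' => h'.2 h.2), Set.inter_union_sdiff]

theorem toFun_diff_of_subset (hS : MeasureTheory.IsSetAlgebra S) (ν : Charge S) {A B : Set Ω}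
    (hA : A ∈ S) (hB : B ∈ S) (h : B ⊆ A) : ν.toFun (A \ B) = ν.toFun A - ν.toFun B := by
  have h' := ν.toFun_inter_add_diff hS hA hB
  rw [Set.inter_eq_self_of_subset_right h] at h'
  linarith

theorem toFun_inter_add_union (hS : MeasureTheory.IsSetAlgebra S) (ν : Charge S) {A B : Set Ω}
    (hA : A ∈ S) (hB : B ∈ S) :
    ν.toFun (A ∩ B) + ν.toFun (A ∪ B) = ν.toFun A + ν.toFun B := by
  have h := ν.toFun_inter_add_diff hS hA hB
  have h' := ν.additive (A \ B) B (hS.sdiff_mem hA hB) hB Set.disjoint_sdiff_left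
  rw [Set.sdiff_union_self] at h'
  linarith

end Charge

section Envelope

variable {Ω : Type*} {S : Set (Set Ω)}

theorem IsProbCharge.mono (hS : MeasureTheory.IsSetAlgebra S) {P : Charge S}
    (hP : IsProbCharge P) {A B : Set Ω} (hA : A ∈ S) (hB : B ∈ S) (h : B ⊆ A) :
    P.toFun B ≤ P.toFun A := by
  have h₁ := P.toFun_diff_of_subset hS hA hB h
  have h₂ := hP.2 (A \ B)
  linarith

theorem HasConvexRange.exists_subset {P : Charge S} (hPcr : HasConvexRange P) {A : Set Ω}
    (hA : A ∈ S) {t : ℝ} (h₀ : 0 ≤ t) (h₁ : t ≤ P.toFun A) :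
    ∃ B ∈ S, B ⊆ A ∧ P.toFun B = t := by
  have h : t ∈ Set.Icc 0 (P.toFun A) := ⟨h₀, h₁⟩
  rwa [← hPcr A hA] at h

/-- The supremum of `μ` over the sets of `P`-mass `t`. -/
noncomputable def massEnvelope (P μ : Charge S) (t : ℝ) : ℝ :=
  sSup {x : ℝ | ∃ B ∈ S, P.toFun B = t ∧ x = μ.toFun B}

theorem smu_eq_massEnvelope (P μ : Charge S) (A : Set Ω) :
    smu P μ A = massEnvelope P μ (P.toFun A) := rfl

theorem le_massEnvelope (P μ : Charge S) {A : Set Ω} (hA : A ∈ S) {t : ℝ}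
    (h : P.toFun A = t) : μ.toFun A ≤ massEnvelope P μ t := by
  obtain ⟨C, hC⟩ := μ.bounded
  refine le_csSup ⟨C, ?_⟩ ⟨A, hA, h, rfl⟩
  rintro _ ⟨B, -, -, rfl⟩
  exact (abs_le.1 (hC B)).2

theorem massEnvelope_le (P μ : Charge S) {A : Set Ω} (hA : A ∈ S) {c : ℝ}
    (h : ∀ B ∈ S, P.toFun B = P.toFun A → μ.toFun B ≤ c) :
    massEnvelope P μ (P.toFun A) ≤ c := by
  refine csSup_le ⟨_, A, hA, rfl, rfl⟩ ?_
  rintro _ ⟨B, hB, hBA, rfl⟩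
  exact h B hB hBA

theorem massEnvelope_add_le (hS : MeasureTheory.IsSetAlgebra S) {P : Charge S}
    (hP : IsProbCharge P) (hPcr : HasConvexRange P) (μ : Charge S) {a b c d : ℝ}
    (ha : 0 ≤ a) (hd : d ≤ 1) (hab : a ≤ b) (hbd : b ≤ d) (h : a + d = b + c) :
    massEnvelope P μ a + massEnvelope P μ d ≤ massEnvelope P μ b + massEnvelope P μ c := by
  obtain ⟨A, hA, -, rfl⟩ := hPcr.exists_subset hS.univ_mem ha
    (by rw [hP.1]; linarith)
  obtain ⟨D, hD, -, rfl⟩ := hPcr.exists_subset hS.univ_mem (t := d) (by linarith)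
    (by rw [hP.1]; linarith)
  have key : ∀ A' ∈ S, P.toFun A' = P.toFun A → ∀ D' ∈ S, P.toFun D' = P.toFun D →
      μ.toFun A' + μ.toFun D' ≤ massEnvelope P μ b + massEnvelope P μ c := by
    intro A' hA' eA D' hD' eD
    have h₁ := P.toFun_inter_add_diff hS hD' hA'
    have h₂ := hP.mono hS hA' (hS.inter_mem hD' hA') Set.inter_subset_right
    obtain ⟨X, hX, hXsub, eX⟩ := hPcr.exists_subset (hS.sdiff_mem hD' hA')
      (t := b - P.toFun A) (by linarith) (by linarith)
    have hdisj : Disjoint A' X := Set.disjoint_left.2 fun _ h h' => (hXsub h').2 h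
    have hXD : X ⊆ D' := hXsub.trans Set.sdiff_subset
    have h₃ := le_massEnvelope P μ (hS.union_mem hA' hX) (t := b)
      (by rw [P.additive _ _ hA' hX hdisj]; linarith)
    have h₄ := le_massEnvelope P μ (hS.sdiff_mem hD' hX) (t := c)
      (by rw [P.toFun_diff_of_subset hS hD' hX hXD]; linarith)
    rw [μ.additive _ _ hA' hX hdisj] at h₃
    rw [μ.toFun_diff_of_subset hS hD' hX hXD] at h₄
    linarith
  rw [← le_sub_iff_add_le]
  refine massEnvelope_le P μ hA fun A' hA' eA => ?_
  rw [le_sub_comm]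
  refine massEnvelope_le P μ hD fun D' hD' eD => ?_
  have := key A' hA' eA D' hD' eD
  linarith

end Envelope

/-- A function on an additive monoid that is subadditive and bounded below is nonnegative. -/
theorem nonneg_of_subadditive_of_bddBelow {M : Type*} [AddMonoid M] {f : M → ℝ}
    (hf : ∀ x y, f (x + y) ≤ f x + f y) {C : ℝ} (hC : ∀ x, -C ≤ f x) (x : M) : 0 ≤ f x := by
  have hn : ∀ n : ℕ, f ((n + 1) • x) ≤ (n + 1) * f x := by
    intro n
    induction n with
    | zero => simp
    | succ n ih =>
      rw [succ_nsmul]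
      have := hf ((n + 1) • x) x
      push_cast
      linarith
  by_contra! hx
  obtain ⟨n, hnC⟩ := exists_nat_gt (C / -f x)
  rw [div_lt_iff₀ (by linarith)] at hnC
  have h₁ := hn n
  have h₂ := hC ((n + 1) • x)
  linarith

/-- Let `P` be a convex-ranged probability charge on an algebra `S` and
`μ` a bounded charge whose positive part `μ⁺` is absolutely continuous with respect to `P`.
Then `s_μ` is a bounded game, it is submodular, and `s_μ(A) ≥ μ(Ω)·P(A)` whenever
`P(A) ∈ (0,1)`. -/
theorem stmt19 {Ω : Type*} (S : Set (Set Ω)) (hS : MeasureTheory.IsSetAlgebra S)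
    (P : Charge S) (hP : IsProbCharge P) (hPcr : HasConvexRange P)
    (μ : Charge S)
    (hac : ∀ A ∈ S, P.toFun A = 0 → posPartFun μ A = 0) :
    smu P μ ∅ = 0 ∧
    (∃ C : ℝ, ∀ A ∈ S, |smu P μ A| ≤ C) ∧
    (∀ A ∈ S, ∀ B ∈ S, smu P μ (A ∩ B) + smu P μ (A ∪ B) ≤ smu P μ A + smu P μ B) ∧
    (∀ A ∈ S, 0 < P.toFun A → P.toFun A < 1 →
      μ.toFun Set.univ * P.toFun A ≤ smu P μ A) := by
  obtain ⟨C, hC⟩ := μ.bounded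
  have hP1 : ∀ A ∈ S, P.toFun A ≤ 1 := fun A hA =>
    hP.1 ▸ hP.mono hS hS.univ_mem hA (Set.subset_univ A)
  have hzero : massEnvelope P μ 0 = 0 := by
    have hP0 := P.toFun_empty hS
    apply le_antisymm
    · suffices h : massEnvelope P μ (P.toFun ∅) ≤ 0 by rwa [hP0] at h
      refine massEnvelope_le P μ hS.empty_mem fun B hB hB0 => ?_
      rw [hP0] at hB0
      rw [← hac B hB hB0]
      refine le_csSup ⟨C, ?_⟩ ⟨B, hB, subset_rfl, rfl⟩
      rintro _ ⟨B', -, -, rfl⟩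
      exact (abs_le.1 (hC B')).2
    · simpa [μ.toFun_empty hS] using le_massEnvelope P μ hS.empty_mem hP0
  have hbdd : ∀ A ∈ S, |smu P μ A| ≤ C := fun A hA => abs_le.2
    ⟨(abs_le.1 (hC A)).1.trans (le_massEnvelope P μ hA rfl),
      massEnvelope_le P μ hA fun B _ _ => (abs_le.1 (hC B)).2⟩
  refine ⟨?_, ⟨C, hbdd⟩, fun A hA B hB => ?_, fun A hA hA0 hA1 => ?_⟩
  · rw [smu_eq_massEnvelope, P.toFun_empty hS, hzero]
  · have hAB := hS.inter_mem hA hB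
    have hAB' := hS.union_mem hA hB
    exact massEnvelope_add_le hS hP hPcr μ (hP.2 _) (hP1 _ hAB')
      (hP.mono hS hA hAB Set.inter_subset_left) (hP.mono hS hAB' hA Set.subset_union_left)
      (P.toFun_inter_add_union hS hA hB)
  · set m := μ.toFun Set.univ with hm
    have hone : m ≤ massEnvelope P μ 1 := le_massEnvelope P μ hS.univ_mem hP.1
    have hfract : ∀ x y : ℝ,
        massEnvelope P μ (Int.fract (x + y)) - m * Int.fract (x + y) ≤
          (massEnvelope P μ (Int.fract x) - m * Int.fract x) +
          (massEnvelope P μ (Int.fract y) - m * Int.fract y) := by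
      intro x y
      have hx₀ := Int.fract_nonneg x
      have hy₀ := Int.fract_nonneg y
      have hx₁ := Int.fract_lt_one x
      have hy₁ := Int.fract_lt_one y
      have hxy : Int.fract (x + y) = Int.fract (Int.fract x + Int.fract y) := by
        rw [Int.fract_eq_fract]
        refine ⟨⌊x⌋ + ⌊y⌋, ?_⟩
        push_cast
        rw [Int.fract, Int.fract]
        ring
      rcases lt_or_ge (Int.fract x + Int.fract y) 1 with h | h
      · have e : Int.fract (x + y) = Int.fract x + Int.fract y := by
          rw [hxy, Int.fract_eq_self.2 ⟨by linarith, h⟩]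
        have := massEnvelope_add_le hS hP hPcr μ le_rfl h.le hx₀
          (le_add_of_nonneg_right hy₀) (zero_add _)
        rw [e]
        linarith
      · have e : Int.fract (x + y) = Int.fract x + Int.fract y - 1 := by
          rw [hxy, ← Int.fract_sub_one, Int.fract_eq_self.2 ⟨by linarith, by linarith⟩]
        have := massEnvelope_add_le hS hP hPcr μ
          (a := Int.fract x + Int.fract y - 1) (b := Int.fract x) (c := Int.fract y)
          (by linarith) le_rfl (by linarith) hx₁.le (by ring)
        rw [e]
        linarith
    have hbelow : ∀ x : ℝ,
        -(C + |m|) ≤ massEnvelope P μ (Int.fract x) - m * Int.fract x := by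
      intro x
      have hx₀ := Int.fract_nonneg x
      have hx₁ := Int.fract_lt_one x
      obtain ⟨B, hB, -, eB⟩ := hPcr.exists_subset hS.univ_mem hx₀ (hP.1 ▸ hx₁.le)
      have h₁ := (abs_le.1 (hbdd B hB)).1
      rw [smu_eq_massEnvelope, eB] at h₁
      have h₂ : m * Int.fract x ≤ |m| := calc
        m * Int.fract x ≤ |m| * Int.fract x := mul_le_mul_of_nonneg_right (le_abs_self m) hx₀
        _ ≤ |m| := mul_le_of_le_one_right (abs_nonneg m) hx₁.le
      linarith
    have h := nonneg_of_subadditive_of_bddBelow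
      (f := fun x : ℝ => massEnvelope P μ (Int.fract x) - m * Int.fract x)
      hfract hbelow (P.toFun A)
    simp only [Int.fract_eq_self.2 ⟨hA0.le, hA1⟩] at h
    rw [smu_eq_massEnvelope]
    linarith
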